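/- arXiv:1712.10133 — 3 statements merged into one kernel-verified Lean document; each statement's English description precedes it below -/
import Mathlib

section
/- Suppose A is a Γ-C*-algebra and B ⊆ A is a Γ-invariant unital C*-subalgebra. Then for any μ ∈ Prob(Γ), every μ-stationary state η on B extends to a μ-stationary state τ on A. In particular, for any Γ-C*-algebra A and any μ ∈ Prob(Γ), the set of μ-stationary states on A is non-empty. -/
noncomputable section
open scoped ComplexOrder ENNReal
open MeasureTheory Filter Topology
set_option linter.unusedSectionVars false
set_option maxHeartbeats 1000000
set_option synthInstance.maxHeartbeats 400000

namespace RW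

/-- A probability distribution on a (countable discrete) group. -/
structure ProbOn (Γ : Type*) where
  w : Γ → ℝ
  nonneg : ∀ g, 0 ≤ w g
  hasSum : HasSum w 1

/-- `μ` is generating: the semigroup generated by its support is the whole group. -/
def ProbOn.Generating {Γ : Type*} [Group Γ] (μ : ProbOn Γ) : Prop :=
  ∀ g : Γ, ∃ l : List Γ, l ≠ [] ∧ (∀ x ∈ l, 0 < μ.w x) ∧ l.prod = g

/-- A state on a unital complex star algebra: a positive unital linear functional. -/
structure AlgState (A : Type*) [Ring A] [StarRing A] [Algebra ℂ A] where
  toFun : A →ₗ[ℂ] ℂ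
  map_one : toFun 1 = 1
  pos : ∀ a : A, 0 ≤ toFun (star a * a)

section CstarAct

variable {Γ : Type*} [Group Γ] {A : Type*} [Ring A] [StarRing A] [Algebra ℂ A]
  [MulSemiringAction Γ A]

/-- A `μ`-stationary state on a `Γ`-C*-algebra. -/
def IsStationaryStateAct (μ : ProbOn Γ) (τ : AlgState A) : Prop :=
  ∀ a : A, HasSum (fun g : Γ => (μ.w g : ℂ) * τ.toFun (g⁻¹ • a)) (τ.toFun a)

/-- Bounded `μ`-harmonic functions. -/
def IsBddHarmonic (μ : ProbOn Γ) (f : Γ → ℂ) : Prop :=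
  (∃ C : ℝ, ∀ g : Γ, ‖f g‖ ≤ C) ∧
  ∀ g : Γ, HasSum (fun h : Γ => (μ.w h : ℂ) * f (g * h)) (f g)

end CstarAct

end RW

namespace RW

section StateNorm

variable {A : Type*} [CStarAlgebra A]

/-- A state on a unital C*-algebra is contractive. -/
theorem AlgState.norm_apply_le (τ : AlgState A) (a : A) : ‖τ.toFun a‖ ≤ ‖a‖ := by
  let _ : PartialOrder A := CStarAlgebra.spectralOrder A
  have : StarOrderedRing A := CStarAlgebra.spectralOrderedRing A
  let f : A →ₚ[ℂ] ℂ := PositiveLinearMap.mk₀ τ.toFun fun x hx => by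
    obtain ⟨y, rfl⟩ := CStarAlgebra.nonneg_iff_eq_star_mul_self.mp hx
    exact τ.pos y
  have hf : ∀ x, f x = τ.toFun x := fun _ => rfl
  have hle : ∀ x : A, ‖f.toPreGNS x‖ ≤ ‖x‖ := fun x => by
    have h1 := f.norm_apply_le_of_nonneg (star x * x) (star_mul_self_nonneg x)
    have h2 : f (star x * x) = ((‖f.toPreGNS x‖ : ℂ)) ^ 2 := (f.preGNS_norm_sq _).symm
    rw [h2, hf 1, τ.map_one, CStarRing.norm_star_mul_self] at h1
    simp only [norm_pow, Complex.norm_real, norm_norm, norm_one, one_mul, ← sq] at h1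
    exact (sq_le_sq₀ (norm_nonneg _) (norm_nonneg _)).mp h1
  have hone : ‖f.toPreGNS 1‖ = 1 := by
    have h2 : ((‖f.toPreGNS 1‖ : ℂ)) ^ 2 = f (star 1 * 1) := f.preGNS_norm_sq _
    rw [star_one, one_mul, hf 1, τ.map_one] at h2
    have h3 : ‖f.toPreGNS 1‖ ^ 2 = 1 := by exact_mod_cast h2
    exact (pow_eq_one_iff_of_nonneg (norm_nonneg _) two_ne_zero).mp h3
  have hcs := norm_inner_le_norm (𝕜 := ℂ) (f.toPreGNS 1) (f.toPreGNS a)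
  rw [f.preGNS_inner_def, hone, one_mul] at hcs
  simpa [hf] using hcs.trans (hle a)

/-- A unital functional of norm at most one takes real values on self-adjoint elements. -/
theorem im_apply_eq_zero_of_isSelfAdjoint {f : A →ₗ[ℂ] ℂ} (hf : ∀ a, ‖f a‖ ≤ ‖a‖)
    (h1 : f 1 = 1) {h : A} (hh : IsSelfAdjoint h) : (f h).im = 0 := by
  have key : ∀ t : ℝ, ((f h).im + t) ^ 2 ≤ ‖h‖ ^ 2 + t ^ 2 := fun t => by
    have hI : f (h + ((t : ℂ) * Complex.I) • (1 : A)) = f h + t * Complex.I := by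
      simp [h1]
    have hstar : star (h + ((t : ℂ) * Complex.I) • (1 : A)) * (h + ((t : ℂ) * Complex.I) • (1 : A))
        = h * h + ((t : ℂ) ^ 2) • (1 : A) := by
      have e : star ((t : ℂ) * Complex.I) = -((t : ℂ) * Complex.I) := by simp
      have e2 : (t : ℂ) ^ 2 = -(((t : ℂ) * Complex.I) * ((t : ℂ) * Complex.I)) := by
        linear_combination ((t : ℂ) ^ 2) * Complex.I_mul_I
      rw [star_add, hh.star_eq, star_smul, star_one, e, e2]
      simp only [add_mul, mul_add, smul_mul_assoc, mul_smul_comm, one_mul, mul_one, neg_smul,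
        neg_mul, smul_neg, smul_add, smul_smul]
      abel
    have : Nontrivial A := ⟨1, 0, fun h0 => by simp [h0] at h1⟩
    have hn : ‖h + ((t : ℂ) * Complex.I) • (1 : A)‖ ^ 2 ≤ ‖h‖ ^ 2 + t ^ 2 := by
      rw [sq, ← CStarRing.norm_star_mul_self, hstar]
      refine (norm_add_le _ _).trans (add_le_add ?_ ?_)
      · rw [sq]; exact norm_mul_le _ _
      · simp [norm_smul]
    have him : |(f h).im + t| ≤ ‖h + ((t : ℂ) * Complex.I) • (1 : A)‖ := by
      have := (Complex.abs_im_le_norm _).trans (hf (h + ((t : ℂ) * Complex.I) • (1 : A)))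
      rw [hI] at this
      simpa using this
    calc ((f h).im + t) ^ 2 = |(f h).im + t| ^ 2 := (sq_abs _).symm
      _ ≤ _ := pow_le_pow_left₀ (abs_nonneg _) him 2
      _ ≤ _ := hn
  by_contra hne
  have := key ((‖h‖ ^ 2 + 1) / (2 * (f h).im))
  have e : 2 * (f h).im * ((‖h‖ ^ 2 + 1) / (2 * (f h).im)) = ‖h‖ ^ 2 + 1 := by
    field_simp
  nlinarith [sq_nonneg (f h).im]

/-- A unital functional of norm at most one on a unital C*-algebra is positive. -/
theorem apply_star_mul_self_nonneg {f : A →ₗ[ℂ] ℂ} (hf : ∀ a, ‖f a‖ ≤ ‖a‖)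
    (h1 : f 1 = 1) (a : A) : 0 ≤ f (star a * a) := by
  let _ : PartialOrder A := CStarAlgebra.spectralOrder A
  have : StarOrderedRing A := CStarAlgebra.spectralOrderedRing A
  have : Nontrivial A := ⟨1, 0, fun h0 => by simp [h0] at h1⟩
  have hsa : IsSelfAdjoint (star a * a) := .star_mul_self a
  have hpos : 0 ≤ star a * a := star_mul_self_nonneg a
  set x := star a * a
  have hle : x ≤ algebraMap ℝ A ‖x‖ := hsa.le_algebraMap_norm_self
  have hnorm : ‖algebraMap ℝ A ‖x‖ - x‖ ≤ ‖x‖ := by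
    have := CStarAlgebra.norm_le_norm_of_nonneg_of_le (sub_nonneg.mpr hle)
      (sub_le_self (algebraMap ℝ A ‖x‖) hpos)
    simpa [norm_algebraMap'] using this
  have hval : f (algebraMap ℝ A ‖x‖ - x) = (‖x‖ : ℂ) - f x := by
    rw [map_sub, Algebra.algebraMap_eq_smul_one, ← Complex.coe_smul, map_smul, h1]
    simp
  have hre := (Complex.re_le_norm _).trans ((hf _).trans hnorm)
  rw [hval] at hre
  simp only [Complex.sub_re, Complex.ofReal_re] at hre
  refine Complex.nonneg_iff.mpr ⟨by linarith, ?_⟩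
  exact (im_apply_eq_zero_of_isSelfAdjoint hf h1 hsa).symm

end StateNorm

section FixedFunctional

open Finset in
/-- If `P` is a contraction and `f₀` a contractive functional, then some contractive functional
is `P`-invariant and agrees with `f₀` wherever `f₀` is constant along the orbit of `P`. -/
theorem exists_invariant_functional {E : Type*} [NormedAddCommGroup E] [NormedSpace ℂ E]
    (P : E →ₗ[ℂ] E) (hP : ∀ x, ‖P x‖ ≤ ‖x‖) (f₀ : E →ₗ[ℂ] ℂ) (hf₀ : ∀ x, ‖f₀ x‖ ≤ ‖x‖) :
    ∃ f : StrongDual ℂ E, (∀ x, ‖f x‖ ≤ ‖x‖) ∧ (∀ x, f (P x) = f x) ∧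
      ∀ x, (∀ n : ℕ, f₀ ((P ^ n) x) = f₀ x) → f x = f₀ x := by
  have hPn : ∀ (n : ℕ) (x : E), ‖(P ^ n) x‖ ≤ ‖x‖ := fun n => by
    induction n with
    | zero => simp
    | succ n ih => intro x; rw [pow_succ']; exact (hP _).trans (ih x)
  let avg : ℕ → E →ₗ[ℂ] ℂ := fun n =>
    ((n : ℂ) + 1)⁻¹ • ∑ k ∈ range (n + 1), f₀ ∘ₗ (P ^ k)
  have avg_apply : ∀ n x, avg n x = ((n : ℂ) + 1)⁻¹ * ∑ k ∈ range (n + 1), f₀ ((P ^ k) x) :=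
    fun n x => by simp [avg, LinearMap.sum_apply]
  have hn0 : ∀ n : ℕ, (n : ℂ) + 1 ≠ 0 := fun n => by exact_mod_cast n.succ_ne_zero
  have hnorm : ∀ n : ℕ, ‖(n : ℂ) + 1‖ = (n : ℝ) + 1 := fun n => by
    exact_mod_cast Complex.norm_natCast (n + 1)
  have havg : ∀ n x, ‖avg n x‖ ≤ 1 * ‖x‖ := fun n x => by
    rw [avg_apply, norm_mul, norm_inv, hnorm, inv_mul_le_iff₀ (by positivity), one_mul]
    refine (norm_sum_le_of_le _ fun k _ => (hf₀ _).trans (hPn k x)).trans ?_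
    simp
  let g : ℕ → WeakDual ℂ E := fun n =>
    StrongDual.toWeakDual ((avg n).mkContinuous 1 (havg n))
  have hg : ∀ n x, g n x = avg n x := fun _ _ => rfl
  have hcomp := WeakDual.isCompact_closedBall (0 : StrongDual ℂ E) 1
  obtain ⟨f, hfmem, hf⟩ := hcomp.ultrafilter_le_nhds ((hyperfilter ℕ).map g) (by
    rw [le_principal_iff]
    refine Filter.mem_map.mpr (Filter.univ_mem' fun n => ?_)
    simpa [g] using (avg n).mkContinuous_norm_le zero_le_one (havg n))
  have htend : Tendsto g (hyperfilter ℕ) (𝓝 f) := hf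
  have hx : ∀ x, Tendsto (fun n => avg n x) (hyperfilter ℕ) (𝓝 (f x)) := fun x =>
    ((WeakDual.eval_continuous x).tendsto f).comp htend
  refine ⟨WeakDual.toStrongDual f, fun x => ?_, fun x => ?_, fun x hfix => ?_⟩
  · refine le_of_tendsto (hx x).norm (Eventually.of_forall fun n => ?_)
    simpa using havg n x
  · have hdiff : ∀ n, ‖avg n (P x) - avg n x‖ ≤ 2 * ‖x‖ * (1 / ((n : ℝ) + 1)) := fun n => by
      have e : avg n (P x) - avg n x = ((n : ℂ) + 1)⁻¹ * (f₀ ((P ^ (n + 1)) x) - f₀ x) := by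
        rw [avg_apply, avg_apply, ← mul_sub, ← sum_sub_distrib]
        have := sum_range_sub (fun k => f₀ ((P ^ k) x)) (n + 1)
        simp only [pow_zero, Module.End.one_apply] at this
        rw [← this]
        simp only [pow_succ, Module.End.mul_apply]
      rw [e, norm_mul, norm_inv, hnorm, mul_comm, one_div]
      gcongr
      refine (norm_sub_le _ _).trans ?_
      linarith [(hf₀ ((P ^ (n + 1)) x)).trans (hPn (n + 1) x), hf₀ x]
    have hz : Tendsto (fun n => avg n (P x) - avg n x) (hyperfilter ℕ) (𝓝 0) := by
      refine squeeze_zero_norm hdiff ?_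
      have := (tendsto_one_div_add_atTop_nhds_zero_nat (𝕜 := ℝ)).const_mul (2 * ‖x‖)
      rw [mul_zero] at this
      exact this.mono_left Nat.hyperfilter_le_atTop
    exact sub_eq_zero.mp (tendsto_nhds_unique ((hx (P x)).sub (hx x)) hz)
  · refine tendsto_nhds_unique (hx x) (tendsto_const_nhds.congr fun n => ?_)
    rw [avg_apply, sum_congr rfl fun k _ => hfix k]
    simp only [sum_const, card_range, nsmul_eq_mul]
    push_cast
    rw [inv_mul_cancel_left₀ (hn0 n)]

end FixedFunctional

section Stationary

variable {Γ : Type*} [Group Γ] {A : Type*} [CStarAlgebra A]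
  [MulSemiringAction Γ A] [SMulCommClass Γ ℂ A]

/-- A group acting by *-automorphisms acts contractively. -/
theorem norm_smul_le_of_smul_star (hstar : ∀ (g : Γ) (a : A), g • (star a) = star (g • a))
    (g : Γ) (a : A) : ‖g • a‖ ≤ ‖a‖ :=
  NonUnitalStarAlgHom.norm_apply_le (F := A →⋆ₐ[ℂ] A)
    { MulSemiringAction.toRingHom Γ A g with
      commutes' := fun c => by simp [Algebra.algebraMap_eq_smul_one, smul_comm g c]
      map_star' := fun x => hstar g x } a

/-- The convolution operator `a ↦ ∑ μ(g) g⁻¹ • a` attached to a probability on `Γ`. -/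
theorem exists_convolution_operator
    (hstar : ∀ (g : Γ) (a : A), g • (star a) = star (g • a)) (μ : ProbOn Γ) :
    ∃ P : A →ₗ[ℂ] A, (∀ a, ‖P a‖ ≤ ‖a‖) ∧
      ∀ a, HasSum (fun g : Γ => (μ.w g : ℂ) • (g⁻¹ • a)) (P a) := by
  have hb : ∀ (a : A) (g : Γ), ‖(μ.w g : ℂ) • (g⁻¹ • a)‖ ≤ μ.w g * ‖a‖ := fun a g => by
    rw [norm_smul, Complex.norm_real, Real.norm_of_nonneg (μ.nonneg g)]
    exact mul_le_mul_of_nonneg_left (norm_smul_le_of_smul_star hstar _ _) (μ.nonneg g)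
  have hs : ∀ a : A, HasSum (fun g => μ.w g * ‖a‖) ‖a‖ := fun a => by
    simpa using μ.hasSum.mul_right ‖a‖
  have hsum : ∀ a : A, Summable fun g : Γ => (μ.w g : ℂ) • (g⁻¹ • a) := fun a =>
    Summable.of_norm_bounded (hs a).summable (hb a)
  refine ⟨{ toFun := fun a => ∑' g : Γ, (μ.w g : ℂ) • (g⁻¹ • a)
            map_add' := fun a b => ?_
            map_smul' := fun c a => ?_ }, fun a => ?_, fun a => (hsum a).hasSum⟩
  · rw [← (hsum a).tsum_add (hsum b)]
    simp only [smul_add]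
  · rw [RingHom.id_apply, ← (hsum a).tsum_const_smul c]
    refine tsum_congr fun g => ?_
    rw [smul_comm g⁻¹ c a, smul_comm c (μ.w g : ℂ)]
  · exact tsum_of_norm_bounded (hs a) (hb a)

/-- Extension of stationary states from invariant C*-subalgebras. -/
theorem exists_stationary_extension
    (hstar : ∀ (g : Γ) (a : A), g • (star a) = star (g • a)) (μ : ProbOn Γ)
    (B : StarSubalgebra ℂ A) (hBclosed : IsClosed (B : Set A))
    (hBinv : ∀ (g : Γ) (b : A), b ∈ B → g • b ∈ B) (η : AlgState ↥B)
    (hη : ∀ b : ↥B,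
      HasSum (fun g : Γ => (μ.w g : ℂ) * η.toFun ⟨g⁻¹ • (b : A), hBinv g⁻¹ b b.2⟩)
        (η.toFun b)) :
    ∃ τ : AlgState A, IsStationaryStateAct μ τ ∧ ∀ b : ↥B, τ.toFun (b : A) = η.toFun b := by
  have : IsClosed (B : Set A) := hBclosed
  have hηnorm : ∀ b : ↥B, ‖η.toFun b‖ ≤ 1 * ‖b‖ := fun b => by
    rw [one_mul]; exact AlgState.norm_apply_le (A := ↥B) η b
  obtain ⟨f₀, hf₀B, hf₀n⟩ := exists_extension_norm_eq (𝕜 := ℂ)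
    (Subalgebra.toSubmodule B.toSubalgebra) (η.toFun.mkContinuous 1 hηnorm)
  replace hf₀B : ∀ b : ↥B, f₀ (b : A) = η.toFun b := fun b => hf₀B b
  have hf₀le : ∀ a, ‖f₀ a‖ ≤ ‖a‖ := fun a => by
    have h1 : ‖f₀‖ ≤ 1 := hf₀n.trans_le (LinearMap.mkContinuous_norm_le _ zero_le_one _)
    simpa using f₀.le_of_opNorm_le h1 a
  obtain ⟨P, hPn, hP⟩ := exists_convolution_operator hstar μ
  have hPB : ∀ b ∈ B, P b ∈ B := fun b hb =>
    hBclosed.mem_of_tendsto (hP b) (Eventually.of_forall fun s =>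
      sum_mem fun g _ => B.smul_mem (hBinv _ _ hb) _)
  have hf₀P : ∀ b ∈ B, f₀ (P b) = f₀ b := fun b hb => by
    have h1 := f₀.hasSum (hP b)
    have h2 := hη ⟨b, hb⟩
    rw [← hf₀B ⟨b, hb⟩] at h2
    have e : (fun g : Γ => (μ.w g : ℂ) * η.toFun ⟨g⁻¹ • b, hBinv g⁻¹ b hb⟩) =
        fun g => f₀ ((μ.w g : ℂ) • (g⁻¹ • b)) := funext fun g => by
      rw [map_smul, smul_eq_mul, ← hf₀B]
    exact h1.unique (e ▸ h2)
  have hfix : ∀ b ∈ B, ∀ n : ℕ, (P ^ n) b ∈ B ∧ f₀ ((P ^ n) b) = f₀ b := fun b hb n => by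
    induction n with
    | zero => simpa using hb
    | succ n ih =>
      rw [pow_succ', Module.End.mul_apply]
      exact ⟨hPB _ ih.1, (hf₀P _ ih.1).trans ih.2⟩
  obtain ⟨f, hfn, hfP, hff₀⟩ := exists_invariant_functional P hPn f₀.toLinearMap hf₀le
  have hfB : ∀ b : ↥B, f (b : A) = η.toFun b := fun b =>
    (hff₀ b fun n => (hfix b b.2 n).2).trans (hf₀B b)
  have hf1 : f 1 = 1 := (hfB 1).trans η.map_one
  refine ⟨⟨f.toLinearMap, hf1, apply_star_mul_self_nonneg (f := f.toLinearMap) hfn hf1⟩,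
    fun a => ?_, hfB⟩
  have h := f.hasSum (hP a)
  rw [hfP] at h
  simpa using h

end Stationary

end RW

open RW in
/-- Every `μ`-stationary state on a `Γ`-invariant unital C*-subalgebra extends to a
`μ`-stationary state on the whole algebra; in particular `μ`-stationary states exist. -/
theorem stationary_state_extension
    {Γ : Type*} [Group Γ] [Countable Γ]
    {A : Type*} [NormedRing A] [StarRing A] [CStarRing A] [NormedAlgebra ℂ A]
    [StarModule ℂ A] [CompleteSpace A]
    [MulSemiringAction Γ A] [SMulCommClass Γ ℂ A]
    (hstar : ∀ (g : Γ) (a : A), g • (star a) = star (g • a))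
    (μ : ProbOn Γ)
    (B : StarSubalgebra ℂ A) (hBclosed : IsClosed (B : Set A))
    (hBinv : ∀ (g : Γ) (b : A), b ∈ B → g • b ∈ B)
    (η : AlgState ↥B)
    (hη : ∀ b : ↥B,
      HasSum (fun g : Γ => (μ.w g : ℂ) * η.toFun ⟨g⁻¹ • (b : A), hBinv g⁻¹ b b.2⟩)
        (η.toFun b)) :
    (∃ τ : AlgState A, IsStationaryStateAct μ τ ∧ ∀ b : ↥B, τ.toFun (b : A) = η.toFun b) ∧
    (∃ τ : AlgState A, IsStationaryStateAct μ τ) := by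
  let _ : CStarAlgebra A := {}
  obtain ⟨τ, hτ, hτη⟩ := exists_stationary_extension hstar μ B hBclosed hBinv η hη
  exact ⟨⟨τ, hτ, hτη⟩, τ, hτ⟩
end
end

section
/- Let μ ∈ Prob(Γ) and suppose (X, ν) is a μ-USB. Then the restriction of the Γ-action to the support of ν is a topological boundary action: for every η ∈ Prob(supp ν) and every x ∈ supp ν there is a sequence (g_i) in Γ with (g_i)_*η → δ_x in the weak* topology. -/
noncomputable section
open scoped ComplexOrder ENNReal
open MeasureTheory Filter Topology
set_option linter.unusedSectionVars false
set_option maxHeartbeats 1000000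
set_option synthInstance.maxHeartbeats 400000

namespace RW

section Meas

variable {Γ : Type*} [Group Γ] {X : Type*} [MeasurableSpace X] [MulAction Γ X]

/-- `ν` is `μ`-stationary: `ν = ∑_g μ(g) g_*ν`. -/
def IsStatMeasure (μ : ProbOn Γ) (ν : Measure X) : Prop :=
  ν = Measure.sum (fun g : Γ => ENNReal.ofReal (μ.w g) • Measure.map (fun x : X => g • x) ν)

/-- Position of the `(Γ,μ)`-random walk at time `n`, given the sequence of increments. -/
def walk (x : ℕ → Γ) (n : ℕ) : Γ := (List.ofFn (fun i : Fin n => x i)).prod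

/-- `P` is the Bernoulli measure `μ^⊗ℕ` on the space of increments of the random walk;
the path measure ℙ_μ is its push-forward under partial products. -/
def IsBernoulli [MeasurableSpace Γ] (μ : ProbOn Γ) (P : Measure (ℕ → Γ)) : Prop :=
  IsProbabilityMeasure P ∧
  ∀ (n : ℕ) (s : Fin n → Γ), P {x | ∀ i : Fin n, x (i : ℕ) = s i}
      = ∏ i, ENNReal.ofReal (μ.w (s i))

/-- Essential freeness of an action on a measure space. -/
def IsEssFree (Γ : Type*) [Group Γ] {X : Type*} [MeasurableSpace X] [MulAction Γ X]
    (ν : Measure X) : Prop :=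
  ∀ g : Γ, g ≠ 1 → ν {x : X | g • x = x} = 0

/-- Essential freeness of the restriction of the action to a subgroup. -/
def IsEssFreeOn (Λ : Subgroup Γ) (ν : Measure X) : Prop :=
  ∀ h : Γ, h ∈ Λ → h ≠ 1 → ν {x : X | h • x = x} = 0

/-- The action is non-singular: each translate of `ν` is equivalent to `ν`. -/
def IsNonSingular (Γ : Type*) [Group Γ] {X : Type*} [MeasurableSpace X] [MulAction Γ X]
    (ν : Measure X) : Prop :=
  ∀ g : Γ, Measure.map (fun x : X => g • x) ν ≪ ν ∧ ν ≪ Measure.map (fun x : X => g • x) ν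

end Meas

section TopMeas

variable {Γ : Type*} [Group Γ] {X : Type*} [TopologicalSpace X] [MeasurableSpace X] [MulAction Γ X]

/-- Weak* convergence of the pushforwards of `ν` under a sequence of group elements
to the Dirac measure at `z`. -/
def TendstoDirac (ν : Measure X) (ws : ℕ → Γ) (z : X) : Prop :=
  ∀ f : C(X, ℝ), Tendsto (fun n => ∫ y, f y ∂(Measure.map (fun x : X => ws n • x) ν))
    atTop (nhds (f z))

/-- `(X, ν)` is a `μ`-boundary: `ν` is a `μ`-stationary probability measure and for
ℙ_μ-almost every path `ω` of the random walk the measures `(ω_n)_*ν` converge weak* to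
a Dirac measure. -/
def IsMuBoundary [MeasurableSpace Γ] (μ : ProbOn Γ) (ν : Measure X) : Prop :=
  IsProbabilityMeasure ν ∧ IsStatMeasure μ ν ∧
  ∀ P : Measure (ℕ → Γ), IsBernoulli μ P →
    ∀ᵐ x ∂P, ∃ z : X, TendstoDirac ν (walk x) z

/-- `(X, ν)` is a `μ`-USB: a `μ`-boundary whose measure is the unique `μ`-stationary
probability measure on `X`. -/
def IsUSB [MeasurableSpace Γ] (μ : ProbOn Γ) (ν : Measure X) : Prop :=
  IsMuBoundary μ ν ∧
  ∀ ν' : Measure X, IsProbabilityMeasure ν' → IsStatMeasure μ ν' → ν' = ν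

/-- The support of a measure: points all of whose neighbourhoods have positive measure. -/
def msupport (ν : Measure X) : Set X := {x : X | ∀ U : Set X, IsOpen U → x ∈ U → 0 < ν U}

/-- `X` is a mean-proximal `Γ`-space: for every generating `μ` there is a unique
`μ`-stationary probability measure, and it makes `X` a `μ`-boundary. -/
def IsMeanProximal (Γ X : Type*) [Group Γ] [MeasurableSpace Γ] [TopologicalSpace X]
    [MeasurableSpace X] [MulAction Γ X] : Prop :=
  ∀ μ : ProbOn Γ, μ.Generating →
    ∃ ν : Measure X, IsMuBoundary μ ν ∧
      ∀ ν' : Measure X, IsProbabilityMeasure ν' → IsStatMeasure μ ν' → ν' = ν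

end TopMeas

end RW

namespace RW

section Walk

variable {Γ : Type*} [Group Γ]

theorem walk_succ (x : ℕ → Γ) (n : ℕ) : walk x (n + 1) = walk x n * x n := by
  rw [walk, List.ofFn_succ', List.concat_eq_append, List.prod_append]
  simp [walk]

variable [Countable Γ] [MeasurableSpace Γ] [DiscreteMeasurableSpace Γ]

/-- The distribution of a single step of the random walk. -/
def ProbOn.law (μ : ProbOn Γ) : Measure Γ :=
  Measure.sum fun g => ENNReal.ofReal (μ.w g) • Measure.dirac g

theorem ProbOn.law_singleton (μ : ProbOn Γ) (g : Γ) :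
    μ.law {g} = ENNReal.ofReal (μ.w g) := by
  rw [ProbOn.law, Measure.sum_apply _ (MeasurableSet.of_discrete), tsum_eq_single g]
  · simp
  · intro h hh
    simp [hh]

instance (μ : ProbOn Γ) : IsProbabilityMeasure μ.law := by
  constructor
  rw [ProbOn.law, Measure.sum_apply _ MeasurableSet.univ]
  simp only [Measure.smul_apply, measure_univ, smul_eq_mul, mul_one]
  rw [← ENNReal.ofReal_tsum_of_nonneg μ.nonneg μ.hasSum.summable, μ.hasSum.tsum_eq,
    ENNReal.ofReal_one]

/-- The Bernoulli measure on the space of increments. -/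
def ProbOn.bernoulli (μ : ProbOn Γ) : Measure (ℕ → Γ) :=
  Measure.infinitePi fun _ : ℕ => μ.law

instance (μ : ProbOn Γ) : IsProbabilityMeasure μ.bernoulli := by
  unfold ProbOn.bernoulli
  infer_instance

theorem ProbOn.isBernoulli_bernoulli (μ : ProbOn Γ) : IsBernoulli μ μ.bernoulli := by
  refine ⟨inferInstance, fun n s => ?_⟩
  classical
  let t : ℕ → Set Γ := fun i => if h : i < n then {s ⟨i, h⟩} else Set.univ
  have hset : {x : ℕ → Γ | ∀ i : Fin n, x (i : ℕ) = s i}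
      = Set.pi (Finset.range n : Set ℕ) t := by
    ext x
    simp only [Set.mem_ofPred_eq, Set.mem_pi, Finset.coe_range, Set.mem_Iio]
    constructor
    · intro h i hi
      simpa [t, hi] using h ⟨i, hi⟩
    · intro h i
      simpa [t] using h i i.2
  rw [hset, ProbOn.bernoulli, Measure.infinitePi_pi _ (fun _ _ => MeasurableSet.of_discrete),
    ← Fin.prod_univ_eq_prod_range (fun i => μ.law (t i)) n]
  exact Finset.prod_congr rfl fun i _ => by simp [t, μ.law_singleton]

theorem measurable_walk (n : ℕ) : Measurable fun x : ℕ → Γ => walk x n := by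
  have : Measurable fun y : Fin n → Γ => (List.ofFn y).prod := Measurable.of_discrete
  exact this.comp (by fun_prop : Measurable fun (x : ℕ → Γ) (i : Fin n) => x i)

/-- The distribution of the random walk at time `n`. -/
def ProbOn.walkLaw (μ : ProbOn Γ) (n : ℕ) : Measure Γ :=
  μ.bernoulli.map fun x => walk x n

instance (μ : ProbOn Γ) (n : ℕ) : IsProbabilityMeasure (μ.walkLaw n) :=
  Measure.isProbabilityMeasure_map (measurable_walk n).aemeasurable

theorem ProbOn.walkLaw_zero (μ : ProbOn Γ) : μ.walkLaw 0 = Measure.dirac 1 := by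
  simp [ProbOn.walkLaw, walk]

theorem ProbOn.indepFun_walk (μ : ProbOn Γ) (n : ℕ) :
    ProbabilityTheory.IndepFun (fun x : ℕ → Γ => walk x n) (fun x => x n) μ.bernoulli := by
  have h := (ProbabilityTheory.iIndepFun_infinitePi (P := fun _ : ℕ => μ.law)
    (X := fun _ g => g) (fun _ => measurable_id)).indepFun_finset
    (Finset.range n) {n} (by simp) (fun i => measurable_pi_apply i)
  let F : (Finset.range n → Γ) → Γ := fun y =>
    (List.ofFn fun i : Fin n => y ⟨i, Finset.mem_range.2 i.2⟩).prod
  let G : (({n} : Finset ℕ) → Γ) → Γ := fun y => y ⟨n, Finset.mem_singleton_self n⟩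
  exact h.comp (φ := F) (ψ := G) Measurable.of_discrete Measurable.of_discrete

theorem ProbOn.walkLaw_succ (μ : ProbOn Γ) (n : ℕ) :
    μ.walkLaw (n + 1) = μ.walkLaw n ∗ₘ μ.law := by
  have h := (μ.indepFun_walk n).map_prod_eq_prod_map_map
    (measurable_walk n).aemeasurable (measurable_pi_apply n).aemeasurable
  have he : μ.bernoulli.map (fun x => x n) = μ.law :=
    Measure.infinitePi_map_eval (fun _ : ℕ => μ.law) n
  rw [he] at h
  rw [Measure.mconv, ProbOn.walkLaw, ProbOn.walkLaw, ← h,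
    Measure.map_map (by fun_prop) ((measurable_walk n).prodMk (measurable_pi_apply n))]
  congr 1
  ext x
  exact walk_succ x n

theorem ProbOn.walkLaw_succ' (μ : ProbOn Γ) (n : ℕ) :
    μ.walkLaw (n + 1) = μ.law ∗ₘ μ.walkLaw n := by
  induction n with
  | zero => rw [μ.walkLaw_succ, μ.walkLaw_zero, Measure.dirac_one_mconv, Measure.mconv_dirac_one]
  | succ n ih => rw [μ.walkLaw_succ (n + 1)]; nth_rw 1 [ih]; rw [Measure.mconv_assoc, ← μ.walkLaw_succ]

end Walk

section Mean

variable {Γ : Type*} [Group Γ]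

/-- Boundedness of a real function. -/
def Bdd {α : Type*} (φ : α → ℝ) : Prop := ∃ C, ∀ g, |φ g| ≤ C

theorem integrable_of_bdd {α : Type*} [MeasurableSpace α] {m : Measure α} [IsFiniteMeasure m]
    {φ : α → ℝ} (hm : Measurable φ) (h : Bdd φ) : Integrable φ m := by
  obtain ⟨C, hC⟩ := h
  exact Integrable.of_bound hm.aestronglyMeasurable C (ae_of_all _ hC)

theorem abs_integral_le_of_abs_le {α : Type*} [MeasurableSpace α] {m : Measure α}
    [IsProbabilityMeasure m] {φ : α → ℝ} {C : ℝ} (hC : ∀ a, |φ a| ≤ C) : |∫ a, φ a ∂m| ≤ C := by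
  simpa using norm_integral_le_of_norm_le_const (μ := m) (f := φ) (ae_of_all _ hC)

theorem integral_swap_of_bdd {α β : Type*} [MeasurableSpace α] [MeasurableSpace β]
    {m : Measure α} {n : Measure β} [IsFiniteMeasure m] [IsFiniteMeasure n] {φ : α → β → ℝ}
    (hm : Measurable (Function.uncurry φ)) {C : ℝ} (hC : ∀ a b, |φ a b| ≤ C) :
    ∫ a, ∫ b, φ a b ∂n ∂m = ∫ b, ∫ a, φ a b ∂m ∂n :=
  integral_integral_swap (integrable_of_bdd hm ⟨C, fun p => hC p.1 p.2⟩)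

variable [Countable Γ] [MeasurableSpace Γ] [DiscreteMeasurableSpace Γ]

/-- The average of the left translates of a function. -/
def avg (m : Measure Γ) (φ : Γ → ℝ) (g : Γ) : ℝ := ∫ h, φ (h * g) ∂m

theorem Bdd.avg {m : Measure Γ} [IsProbabilityMeasure m] {φ : Γ → ℝ} (h : Bdd φ) :
    Bdd (avg m φ) := by
  obtain ⟨C, hC⟩ := h
  exact ⟨C, fun g => abs_integral_le_of_abs_le fun a => hC _⟩

theorem avg_mconv (m n : Measure Γ) [IsProbabilityMeasure m] [IsProbabilityMeasure n]
    {φ : Γ → ℝ} (h : Bdd φ) : avg (m ∗ₘ n) φ = avg n (avg m φ) := by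
  obtain ⟨C, hC⟩ := h
  ext g
  have hi : Integrable (fun k => φ (k * g)) (m ∗ₘ n) :=
    integrable_of_bdd Measurable.of_discrete ⟨C, fun _ => hC _⟩
  simp only [avg]
  rw [integral_mconv hi, integral_swap_of_bdd Measurable.of_discrete (fun _ _ => hC _)]
  simp only [mul_assoc]

/-- `L` is an `m`-invariant mean on the bounded functions on `Γ`. -/
structure IsInvMean (m : Measure Γ) (L : (Γ → ℝ) → ℝ) : Prop where
  add : ∀ φ ψ, Bdd φ → Bdd ψ → L (fun g => φ g + ψ g) = L φ + L ψ
  smul : ∀ (c : ℝ) φ, Bdd φ → L (fun g => c * φ g) = c * L φ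
  mono : ∀ φ ψ, Bdd φ → Bdd ψ → (∀ g, φ g ≤ ψ g) → L φ ≤ L ψ
  one : L (fun _ => 1) = 1
  inv : ∀ φ, Bdd φ → L (avg m φ) = L φ

theorem exists_ultrafilter_limit {a : ℕ → ℝ} {C : ℝ} (h : ∀ n, |a n| ≤ C) (U : Ultrafilter ℕ) :
    Tendsto a U (𝓝 (limUnder (U : Filter ℕ) a)) := by
  apply tendsto_nhds_limUnder
  obtain ⟨x, -, hx⟩ := (isCompact_Icc (a := -C) (b := C)).ultrafilter_le_nhds (U.map a)
    (le_principal_iff.2 (Filter.mem_map.2 (Filter.univ_mem' fun n => abs_le.1 (h n))))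
  exact ⟨x, hx⟩

theorem abs_cesaro_le {a : ℕ → ℝ} {C : ℝ} (h : ∀ n, |a n| ≤ C) (N : ℕ) :
    |(∑ k ∈ Finset.range N, a k) / N| ≤ C := by
  have hC : 0 ≤ C := (abs_nonneg _).trans (h 0)
  rw [abs_div, Nat.abs_cast]
  refine div_le_of_le_mul₀ (Nat.cast_nonneg N) hC ((Finset.abs_sum_le_sum_abs _ _).trans ?_)
  refine (Finset.sum_le_sum fun k _ => h k).trans ?_
  simp [mul_comm]

theorem exists_isInvMean (μ : ProbOn Γ) : ∃ L, IsInvMean μ.law L := by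
  let U : Ultrafilter ℕ := Filter.hyperfilter ℕ
  let A : (Γ → ℝ) → ℕ → ℝ := fun φ N =>
    (∑ k ∈ Finset.range N, avg (μ.walkLaw k) φ 1) / N
  have hU : (U : Filter ℕ) ≤ atTop := Nat.hyperfilter_le_atTop
  have hint : ∀ φ : Γ → ℝ, Bdd φ → ∀ k, Integrable (fun h => φ (h * 1)) (μ.walkLaw k) :=
    fun φ ⟨C, hC⟩ k => integrable_of_bdd Measurable.of_discrete ⟨C, fun _ => hC _⟩
  have hlim : ∀ φ, Bdd φ → Tendsto (A φ) U (𝓝 (limUnder (U : Filter ℕ) (A φ))) := by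
    rintro φ ⟨C, hC⟩
    exact exists_ultrafilter_limit
      (fun N => abs_cesaro_le (fun k => abs_integral_le_of_abs_le fun a => hC _) N) U
  refine ⟨fun φ => limUnder (U : Filter ℕ) (A φ), ?_, ?_, ?_, ?_, ?_⟩
  · intro φ ψ hφ hψ
    refine Tendsto.limUnder_eq (((hlim φ hφ).add (hlim ψ hψ)).congr fun N => ?_)
    simp only [A, ← add_div, ← Finset.sum_add_distrib, avg]
    congr 1
    exact Finset.sum_congr rfl fun k _ => (integral_add (hint φ hφ k) (hint ψ hψ k)).symm
  · intro c φ hφ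
    refine Tendsto.limUnder_eq (((hlim φ hφ).const_mul c).congr fun N => ?_)
    simp only [A, avg, integral_const_mul, ← Finset.mul_sum, mul_div_assoc]
  · intro φ ψ hφ hψ h
    refine le_of_tendsto_of_tendsto' (hlim φ hφ) (hlim ψ hψ) fun N => ?_
    exact div_le_div_of_nonneg_right (Finset.sum_le_sum fun k _ =>
      integral_mono (hint φ hφ k) (hint ψ hψ k) fun g => h _) (Nat.cast_nonneg N)
  · refine Tendsto.limUnder_eq (Tendsto.mono_left ?_ hU)
    refine tendsto_const_nhds.congr' ?_
    filter_upwards [eventually_gt_atTop 0] with N hN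
    have : (N : ℝ) ≠ 0 := by positivity
    simp [A, avg, this]
  · intro φ hφ
    refine Tendsto.limUnder_eq ?_
    obtain ⟨C, hC⟩ := id hφ
    have hb : ∀ k, |avg (μ.walkLaw k) φ 1| ≤ C := fun k =>
      abs_integral_le_of_abs_le fun a => hC _
    have hdiff : ∀ N, A (avg μ.law φ) N
        = A φ N + (avg (μ.walkLaw N) φ 1 - avg (μ.walkLaw 0) φ 1) / N := by
      intro N
      have h1 : ∀ k, avg (μ.walkLaw k) (avg μ.law φ) 1 = avg (μ.walkLaw (k + 1)) φ 1 := by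
        intro k
        rw [μ.walkLaw_succ', avg_mconv _ _ hφ]
      simp only [A, h1]
      rw [← Finset.sum_range_sub (fun k => avg (μ.walkLaw k) φ 1), Finset.sum_sub_distrib]
      ring
    have h0 : Tendsto (fun N : ℕ =>
        (avg (μ.walkLaw N) φ 1 - avg (μ.walkLaw 0) φ 1) / (N : ℝ)) atTop (𝓝 0) := by
      refine squeeze_zero_norm (a := fun N : ℕ => 2 * C / (N : ℝ)) (fun N => ?_)
        (tendsto_const_div_atTop_nhds_zero_nat _)
      rw [norm_div, Real.norm_natCast]
      gcongr
      calc _ ≤ |avg (μ.walkLaw N) φ 1| + |avg (μ.walkLaw 0) φ 1| := abs_sub _ _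
        _ ≤ 2 * C := by linarith [hb N, hb 0]
    simpa [← hdiff] using (hlim φ hφ).add (h0.mono_left hU)

theorem IsInvMean.avg_walkLaw {μ : ProbOn Γ} {L : (Γ → ℝ) → ℝ} (hL : IsInvMean μ.law L) (n : ℕ)
    {φ : Γ → ℝ} (hφ : Bdd φ) : L (avg (μ.walkLaw n) φ) = L φ := by
  induction n with
  | zero =>
    congr 1
    ext g
    simp [avg, μ.walkLaw_zero]
  | succ n ih => rw [μ.walkLaw_succ, avg_mconv _ _ hφ, hL.inv _ hφ.avg, ih]

end Mean

section Action

variable {Γ : Type*} [Group Γ] [Countable Γ] [MeasurableSpace Γ] [DiscreteMeasurableSpace Γ]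
  {X : Type*} [TopologicalSpace X] [CompactSpace X] [MeasurableSpace X] [BorelSpace X]
  [MulAction Γ X] [ContinuousConstSMul Γ X]

theorem _root_.Continuous.bdd {f : X → ℝ} (hf : Continuous f) : Bdd f :=
  ⟨‖(⟨f, hf⟩ : C(X, ℝ))‖, fun x => (⟨f, hf⟩ : C(X, ℝ)).norm_coe_le_norm x⟩

theorem measurable_smul_prod : Measurable fun p : Γ × X => p.1 • p.2 :=
  measurable_from_prod_countable_right fun g => (continuous_const_smul g).measurable

/-- The function `g ↦ ∫ f d(g_*η)` on the group. -/
def transform (η : Measure X) (f : X → ℝ) (g : Γ) : ℝ := ∫ y, f (g • y) ∂η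

theorem bdd_transform (η : Measure X) [IsProbabilityMeasure η] {f : X → ℝ}
    (hf : Continuous f) : Bdd (transform (Γ := Γ) η f) := by
  obtain ⟨C, hC⟩ := hf.bdd
  exact ⟨C, fun g => abs_integral_le_of_abs_le fun a => hC _⟩

theorem integrable_translate (η : Measure X) [IsFiniteMeasure η] {f : X → ℝ}
    (hf : Continuous f) (g : Γ) : Integrable (fun y => f (g • y)) η :=
  have h : Continuous fun y => f (g • y) := hf.comp (continuous_const_smul g)
  integrable_of_bdd h.measurable h.bdd

theorem continuous_integral_family {m : Measure Γ} [IsFiniteMeasure m] {F : Γ → X → ℝ}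
    (hF : ∀ g, Continuous (F g)) {C : ℝ} (hC : ∀ g y, |F g y| ≤ C) [FirstCountableTopology X] :
    Continuous fun y => ∫ g, F g y ∂m :=
  continuous_of_dominated (bound := fun _ => C)
    (fun _ => Measurable.of_discrete.aestronglyMeasurable)
    (fun y => ae_of_all _ fun g => hC g y) (integrable_const C) (ae_of_all _ hF)

theorem transform_integral_family {m : Measure Γ} [IsFiniteMeasure m] {F : Γ → X → ℝ}
    (hF : ∀ g, Continuous (F g)) {C : ℝ} (hC : ∀ g y, |F g y| ≤ C) (η : Measure X)
    [IsFiniteMeasure η] (g : Γ) :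
    transform η (fun y => ∫ a, F a y ∂m) g = ∫ a, transform η (F a) g ∂m := by
  have hm : Measurable (Function.uncurry fun (y : X) (a : Γ) => F a (g • y)) :=
    measurable_from_prod_countable_left fun a =>
      ((hF a).comp (continuous_const_smul g)).measurable
  exact integral_swap_of_bdd hm fun _ _ => hC _ _

theorem avg_transform {m : Measure Γ} [IsProbabilityMeasure m] {f : X → ℝ} (hf : Continuous f)
    (η : Measure X) [IsProbabilityMeasure η] :
    avg m (transform η f) = transform η (fun y => ∫ a, f (a • y) ∂m) := by
  obtain ⟨C, hC⟩ := hf.bdd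
  ext g
  rw [transform_integral_family (F := fun a y => f (a • y))
    (fun a => hf.comp (continuous_const_smul a)) (fun _ _ => hC _)]
  simp only [avg, transform, mul_smul]

theorem sum_map_smul_eq (μ : ProbOn Γ) (ν : Measure X) [SFinite ν] :
    Measure.sum (fun g : Γ => ENNReal.ofReal (μ.w g) • Measure.map (fun x : X => g • x) ν)
      = Measure.map (fun p : Γ × X => p.1 • p.2) (μ.law.prod ν) := by
  rw [ProbOn.law, Measure.prod_sum_left, Measure.map_sum measurable_smul_prod.aemeasurable]
  congr 1
  ext1 g
  rw [Measure.prod_smul_left, Measure.map_smul, Measure.dirac_prod,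
    Measure.map_map measurable_smul_prod (by fun_prop)]
  rfl

variable [TopologicalSpace.MetrizableSpace X]

theorem isStatMeasure_of_integral {μ : ProbOn Γ} {ν : Measure X} [IsProbabilityMeasure ν]
    (h : ∀ f : X → ℝ, Continuous f → ∫ y, ∫ a, f (a • y) ∂μ.law ∂ν = ∫ y, f y ∂ν) :
    IsStatMeasure μ ν := by
  rw [IsStatMeasure, sum_map_smul_eq]
  have : IsProbabilityMeasure (Measure.map (fun p : Γ × X => p.1 • p.2) (μ.law.prod ν)) :=
    Measure.isProbabilityMeasure_map measurable_smul_prod.aemeasurable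
  let _ := TopologicalSpace.metrizableSpaceMetric X
  refine ext_of_forall_integral_eq_of_IsFiniteMeasure fun f => ?_
  obtain ⟨C, hC⟩ := f.continuous.bdd
  have hm : Measurable fun p : Γ × X => f (p.1 • p.2) :=
    f.continuous.measurable.comp measurable_smul_prod
  rw [integral_map measurable_smul_prod.aemeasurable
    f.continuous.measurable.aestronglyMeasurable,
    integral_prod _ (integrable_of_bdd hm ⟨C, fun _ => hC _⟩),
    integral_swap_of_bdd hm (fun _ _ => hC _), h f f.continuous]

/-- If the stationary measure is unique, every invariant mean transforms every probability
measure into it. -/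
theorem IsInvMean.transform_eq {μ : ProbOn Γ} {L : (Γ → ℝ) → ℝ} (hL : IsInvMean μ.law L)
    {ν : Measure X}
    (huniq : ∀ ν' : Measure X, IsProbabilityMeasure ν' → IsStatMeasure μ ν' → ν' = ν)
    (η : Measure X) [IsProbabilityMeasure η] {f : X → ℝ} (hf : Continuous f) :
    L (transform η f) = ∫ y, f y ∂ν := by
  let _ := TopologicalSpace.metrizableSpaceMetric X
  let Λ : CompactlySupportedContinuousMap X ℝ →ₚ[ℝ] ℝ :=
    { toFun := fun f => L (transform η f)
      map_add' := fun f f' => by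
        refine Eq.trans (congrArg L ?_)
          (hL.add _ _ (bdd_transform η f.continuous) (bdd_transform η f'.continuous))
        ext g
        exact integral_add (integrable_translate η f.continuous g)
          (integrable_translate η f'.continuous g)
      map_smul' := fun c f => by
        refine Eq.trans (congrArg L ?_) (hL.smul c _ (bdd_transform η f.continuous))
        ext g
        exact integral_const_mul _ _
      monotone' := fun f f' h =>
        hL.mono _ _ (bdd_transform η f.continuous) (bdd_transform η f'.continuous) fun g =>
          integral_mono (integrable_translate η f.continuous g)
            (integrable_translate η f'.continuous g) fun y => h _ }
  have hΛ : ∀ f : X → ℝ, Continuous f →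
      ∫ y, f y ∂(RealRMK.rieszMeasure Λ) = L (transform η f) := fun f hf =>
    RealRMK.integral_rieszMeasure Λ
      { toFun := f, continuous_toFun := hf, hasCompactSupport' := .of_compactSpace _ }
  have hprob : IsProbabilityMeasure (RealRMK.rieszMeasure Λ) := by
    have h1 := hΛ (fun _ => 1) continuous_const
    have h2 : transform (Γ := Γ) η (fun _ => 1) = fun _ => 1 := by
      ext g
      simp [transform]
    rw [h2, hL.one, integral_const, smul_eq_mul, mul_one] at h1
    exact ⟨by simpa [measureReal_def, ENNReal.toReal_eq_one_iff] using h1⟩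
  have hstat : IsStatMeasure μ (RealRMK.rieszMeasure Λ) := by
    refine isStatMeasure_of_integral fun f hf => ?_
    obtain ⟨C, hC⟩ := hf.bdd
    rw [hΛ f hf, hΛ _ (continuous_integral_family (F := fun a y => f (a • y))
      (fun a => hf.comp (continuous_const_smul a)) (fun _ _ => hC _)),
      ← avg_transform hf, hL.inv _ (bdd_transform η hf)]
  rw [← huniq _ hprob hstat, hΛ f hf]

/-- The variance of `f` with respect to `g_*η`. -/
def variation (η : Measure X) (f : X → ℝ) (g : Γ) : ℝ :=
  transform η (fun y => f y ^ 2) g - transform η f g ^ 2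

theorem variation_eq_sub (η : Measure X) [IsProbabilityMeasure η] {f : X → ℝ}
    (hf : Continuous f) (g : Γ) (c : ℝ) :
    variation η f g = transform η (fun y => (f y - c) ^ 2) g - (transform η f g - c) ^ 2 := by
  have h1 : Integrable (fun y => f (g • y) ^ 2) η := integrable_translate η (hf.pow 2) g
  have h2 := (integrable_translate η hf g).const_mul (2 * c)
  have h : transform η (fun y => (f y - c) ^ 2) g
      = transform η (fun y => f y ^ 2) g - 2 * c * transform η f g + c ^ 2 := by
    calc _ = ∫ y, (f (g • y) ^ 2 - 2 * c * f (g • y)) + c ^ 2 ∂η :=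
          integral_congr_ae (ae_of_all _ fun y => by ring)
      _ = _ := by
        rw [integral_add (by exact h1.sub h2) (integrable_const _), integral_sub h1 h2,
          integral_const_mul]
        simp [transform]
  rw [h, variation]
  ring

theorem variation_le (η : Measure X) [IsProbabilityMeasure η] {f : X → ℝ}
    (hf : Continuous f) (g : Γ) (c : ℝ) :
    variation η f g ≤ transform η (fun y => (f y - c) ^ 2) g := by
  rw [variation_eq_sub η hf g c]
  linarith [sq_nonneg (transform η f g - c)]

theorem variation_eq (η : Measure X) [IsProbabilityMeasure η] {f : X → ℝ}
    (hf : Continuous f) (g : Γ) :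
    variation η f g = transform η (fun y => (f y - transform η f g) ^ 2) g := by
  rw [variation_eq_sub η hf g (transform η f g)]
  ring

theorem bdd_variation (η : Measure X) [IsProbabilityMeasure η] {f : X → ℝ}
    (hf : Continuous f) : Bdd (variation (Γ := Γ) η f) := by
  obtain ⟨C, hC⟩ := bdd_transform (Γ := Γ) η (hf.pow 2)
  obtain ⟨D, hD⟩ := bdd_transform (Γ := Γ) η hf
  refine ⟨C + D ^ 2, fun g => (abs_sub _ _).trans (add_le_add (hC g) ?_)⟩
  rw [abs_pow]
  exact pow_le_pow_left₀ (abs_nonneg _) (hD g) 2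

theorem IsInvMean.variation_le_integral {μ : ProbOn Γ} {L : (Γ → ℝ) → ℝ}
    (hL : IsInvMean μ.law L) {ν : Measure X} [IsProbabilityMeasure ν]
    (huniq : ∀ ν' : Measure X, IsProbabilityMeasure ν' → IsStatMeasure μ ν' → ν' = ν)
    (η : Measure X) [IsProbabilityMeasure η] {f : X → ℝ} (hf : Continuous f) (n : ℕ) :
    L (variation η f) ≤ ∫ a, variation ν f a ∂(μ.walkLaw n) := by
  let _ := TopologicalSpace.metrizableSpaceMetric X
  let F : Γ → X → ℝ := fun a y => (f (a • y) - transform ν f a) ^ 2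
  have hF : ∀ a, Continuous (F a) := fun a =>
    ((hf.comp (continuous_const_smul a)).sub continuous_const).pow 2
  obtain ⟨C, hC⟩ := hf.bdd
  have hb : ∀ a y, |F a y| ≤ (2 * C) ^ 2 := fun a y => by
    rw [abs_pow]
    refine pow_le_pow_left₀ (abs_nonneg _) ((abs_sub _ _).trans ?_) 2
    have := hC (a • y)
    have : |transform ν f a| ≤ C := abs_integral_le_of_abs_le fun y => hC _
    linarith
  have hFc := continuous_integral_family (m := μ.walkLaw n) hF hb
  calc L (variation η f) = L (avg (μ.walkLaw n) (variation η f)) :=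
        (hL.avg_walkLaw n (bdd_variation η hf)).symm
    _ ≤ L (transform η fun y => ∫ a, F a y ∂(μ.walkLaw n)) := by
        refine hL.mono _ _ (bdd_variation η hf).avg (bdd_transform η hFc) fun g => ?_
        rw [transform_integral_family hF hb]
        obtain ⟨D, hD⟩ := bdd_variation (Γ := Γ) η hf
        refine integral_mono (integrable_of_bdd Measurable.of_discrete ⟨D, fun _ => hD _⟩)
          (integrable_of_bdd Measurable.of_discrete
            ⟨_, fun a => abs_integral_le_of_abs_le fun y => hb a _⟩) fun a => ?_
        simpa [transform, F, mul_smul] using variation_le η hf (a * g) (transform ν f a)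
    _ = ∫ y, ∫ a, F a y ∂(μ.walkLaw n) ∂ν := hL.transform_eq huniq η hFc
    _ = ∫ a, variation ν f a ∂(μ.walkLaw n) := by
        have hm : Measurable (Function.uncurry fun (y : X) (a : Γ) => F a y) :=
          measurable_from_prod_countable_left fun a => (hF a).measurable
        rw [integral_swap_of_bdd hm fun _ _ => hb _ _]
        simp only [variation_eq ν hf]
        rfl

theorem IsMuBoundary.tendsto_integral_variation {μ : ProbOn Γ} {ν : Measure X}
    (h : IsMuBoundary μ ν) {f : X → ℝ} (hf : Continuous f) :
    Tendsto (fun n => ∫ a, variation ν f a ∂(μ.walkLaw n)) atTop (𝓝 0) := by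
  have := h.1
  obtain ⟨D, hD⟩ := bdd_variation (Γ := Γ) ν hf
  have hmap : ∀ n, ∫ a, variation ν f a ∂(μ.walkLaw n)
      = ∫ x, variation ν f (walk x n) ∂μ.bernoulli := fun n =>
    integral_map (measurable_walk n).aemeasurable Measurable.of_discrete.aestronglyMeasurable
  simp only [hmap]
  rw [← integral_zero (ℕ → Γ) ℝ (μ := μ.bernoulli)]
  refine tendsto_integral_of_dominated_convergence (fun _ => D) (fun n => ?_)
    (integrable_const D) (fun n => ae_of_all _ fun x => hD _) ?_
  · have hm : Measurable (variation (Γ := Γ) ν f) := Measurable.of_discrete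
    exact (hm.comp (measurable_walk n)).aestronglyMeasurable
  · filter_upwards [h.2.2 _ μ.isBernoulli_bernoulli] with x ⟨z, hz⟩
    have hz' : ∀ k : X → ℝ, Continuous k →
        Tendsto (fun n => transform ν k (walk x n)) atTop (𝓝 (k z)) := fun k hk => by
      refine (hz ⟨k, hk⟩).congr fun n => ?_
      exact integral_map (continuous_const_smul _).measurable.aemeasurable
        hk.measurable.aestronglyMeasurable
    have hsub : Tendsto (fun n => variation ν f (walk x n)) atTop (𝓝 (f z ^ 2 - f z ^ 2)) :=
      (hz' (fun y => f y ^ 2) (hf.pow 2)).sub ((hz' f hf).pow 2)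
    rwa [sub_self] at hsub

end Action

section Support

variable {Γ : Type*} [Group Γ] [Countable Γ] [MeasurableSpace Γ] [DiscreteMeasurableSpace Γ]
  {X : Type*} [MetricSpace X] [CompactSpace X] [MeasurableSpace X] [BorelSpace X]
  [MulAction Γ X] [ContinuousConstSMul Γ X]

theorem IsUSB.exists_transform_dist_lt {μ : ProbOn Γ} {ν : Measure X} (h : IsUSB μ ν)
    (η : Measure X) [IsProbabilityMeasure η] {x : X} (hx : x ∈ msupport ν) {ε : ℝ}
    (hε : 0 < ε) : ∃ g : Γ, transform η (fun y => dist y x) g < ε := by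
  have := h.1.1
  by_contra! hcon
  obtain ⟨L, hL⟩ := exists_isInvMean μ
  let f : X → ℝ := fun y => dist y x
  have hf : Continuous f := by fun_prop
  let δ := ε / 2
  have hδ : 0 < δ := by positivity
  let k : X → ℝ := fun y => max 0 (δ - dist y x)
  have hk : Continuous k := by fun_prop
  have hkδ : Continuous fun y => δ * k y := by fun_prop
  have hV : L (variation η f) ≤ 0 :=
    ge_of_tendsto' (h.1.tendsto_integral_variation hf)
      fun n => hL.variation_le_integral h.2 η hf n
  have hle : ∫ y, δ * k y ∂ν ≤ L (variation η f) := by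
    rw [← hL.transform_eq h.2 η hkδ]
    refine hL.mono _ _ (bdd_transform η hkδ) (bdd_variation η hf) fun g => ?_
    rw [variation_eq η hf]
    have hc : ε ≤ transform η f g := hcon g
    refine integral_mono (integrable_translate η hkδ g)
      (integrable_translate η ((hf.sub continuous_const).pow 2) g) fun y => ?_
    have hd : 0 ≤ dist (g • y) x := dist_nonneg
    have hεδ : ε = 2 * δ := by simp only [δ]; ring
    show δ * max 0 (δ - dist (g • y) x) ≤ (dist (g • y) x - transform η f g) ^ 2
    rcases le_total δ (dist (g • y) x) with h1 | h1
    · rw [max_eq_left (by linarith), mul_zero]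
      positivity
    · rw [max_eq_right (by linarith)]
      nlinarith
  have hpos : 0 < ∫ y, δ * k y ∂ν := by
    rw [integral_const_mul]
    refine mul_pos hδ ?_
    have h0 : 0 ≤ k := fun y => le_max_left _ _
    rw [integral_pos_iff_support_of_nonneg h0 (integrable_of_bdd hk.measurable hk.bdd)]
    refine hx _ hk.isOpen_support ?_
    simp [k, hδ.ne', hδ.le]
  linarith

theorem tendstoDirac_of_tendsto_transform_dist {η : Measure X} [IsProbabilityMeasure η]
    {gs : ℕ → Γ} {x : X}
    (h : Tendsto (fun n => transform η (fun y => dist y x) (gs n)) atTop (𝓝 0)) :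
    TendstoDirac η gs x := by
  intro f
  have hmap : ∀ n, ∫ y, f y ∂(Measure.map (fun y : X => gs n • y) η)
      = transform η f (gs n) := fun n =>
    integral_map (continuous_const_smul _).measurable.aemeasurable
      f.continuous.measurable.aestronglyMeasurable
  simp only [hmap]
  rw [Metric.tendsto_atTop']
  intro ε hε
  obtain ⟨δ, hδ, hfδ⟩ := Metric.continuousAt_iff.1 f.continuous.continuousAt (ε / 2) (half_pos hε)
  let K := 2 * ‖f‖ / δ
  have hK : 0 ≤ K := by positivity
  have hbound : ∀ y, |f y - f x| ≤ ε / 2 + K * dist y x := by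
    intro y
    rcases lt_or_ge (dist y x) δ with hy | hy
    · have h1 := (hfδ hy).le
      rw [Real.dist_eq] at h1
      have : 0 ≤ K * dist y x := by positivity
      linarith
    · have h1 : |f y - f x| ≤ 2 * ‖f‖ := by
        refine (abs_sub _ _).trans ?_
        have h2 := f.norm_coe_le_norm y
        have h3 := f.norm_coe_le_norm x
        rw [Real.norm_eq_abs] at h2 h3
        linarith
      have h4 : 2 * ‖f‖ = K * δ := by
        simp only [K]
        field_simp
      have := mul_le_mul_of_nonneg_left hy hK
      linarith
  have hd : Continuous fun y : X => dist y x := by fun_prop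
  have hdist : ∀ g : Γ, |transform η f g - f x|
      ≤ ε / 2 + K * transform η (fun y => dist y x) g := by
    intro g
    have hi := integrable_translate η f.continuous g
    have hid := (integrable_translate η hd g).const_mul K
    calc |transform η f g - f x| = |∫ y, f (g • y) - f x ∂η| := by
          rw [integral_sub hi (integrable_const _)]
          simp [transform]
      _ ≤ ∫ y, |f (g • y) - f x| ∂η := abs_integral_le_integral_abs
      _ ≤ ∫ y, ε / 2 + K * dist (g • y) x ∂η :=
          integral_mono (hi.sub (integrable_const _)).abs ((integrable_const _).add hid)
            fun y => hbound _
      _ = ε / 2 + K * transform η (fun y => dist y x) g := by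
          rw [integral_add (integrable_const _) hid, integral_const_mul]
          simp [transform]
  have hlim : Tendsto (fun n => ε / 2 + K * transform η (fun y => dist y x) (gs n)) atTop
      (𝓝 (ε / 2)) := by
    simpa using (h.const_mul K).const_add (ε / 2)
  obtain ⟨N, hN⟩ := eventually_atTop.1 (hlim.eventually_lt_const (half_lt_self hε))
  exact ⟨N, fun n hn => by
    rw [Real.dist_eq]
    exact (hdist _).trans_lt (hN n hn.le)⟩

theorem IsUSB.exists_tendstoDirac {μ : ProbOn Γ} {ν : Measure X} (h : IsUSB μ ν)
    (η : Measure X) [IsProbabilityMeasure η] {x : X} (hx : x ∈ msupport ν) :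
    ∃ gs : ℕ → Γ, TendstoDirac η gs x := by
  choose gs hgs using fun n : ℕ =>
    h.exists_transform_dist_lt η hx (Nat.one_div_pos_of_nat (α := ℝ) (n := n))
  exact ⟨gs, tendstoDirac_of_tendsto_transform_dist
    (squeeze_zero (fun n => integral_nonneg fun y => dist_nonneg) (fun n => (hgs n).le)
      tendsto_one_div_add_atTop_nhds_zero_nat)⟩

end Support

end RW

open RW in
/-- A `μ`-USB restricted to the support of its stationary measure is a topological
boundary action. -/
theorem usb_support_is_topological_boundary
    {Γ : Type*} [Group Γ] [Countable Γ] [MeasurableSpace Γ] [DiscreteMeasurableSpace Γ]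
    {X : Type*} [TopologicalSpace X] [CompactSpace X] [TopologicalSpace.MetrizableSpace X]
    [MeasurableSpace X] [BorelSpace X] [MulAction Γ X]
    (hcont : ∀ g : Γ, Continuous fun x : X => g • x)
    (μ : ProbOn Γ) (ν : Measure X) (hUSB : IsUSB μ ν) :
    ∀ η : Measure X, IsProbabilityMeasure η → η (msupport ν) = 1 →
      ∀ x ∈ msupport ν, ∃ gs : ℕ → Γ, TendstoDirac η gs x := by
  intro η hη _ x hx
  let _ := TopologicalSpace.metrizableSpaceMetric X
  have : ContinuousConstSMul Γ X := ⟨hcont⟩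
  exact hUSB.exists_tendstoDirac η hx
end
end

section
/- (0-1 Law for Noetherian actions) Let Γ act continuously on a compact metrizable space X, let μ ∈ Prob(Γ) be generating, and let ν ∈ Prob(X) be an ergodic μ-stationary measure such that (X,ν) has no non-trivial finite factor, i.e. there is no n ≥ 2 and Borel set Y with ν(Y) = 1/n whose Γ-translates take only finitely many values modulo ν-null sets and partition X up to ν-null sets. Let F be a Γ-Noetherian lower semilattice in the measure algebra of ν: F is a family of ν-equivalence classes of Borel sets that is invariant under the Γ-action, closed under intersections, and such that every descending chain Y_1 ⊇ Y_2 ⊇ ⋯ in F (inclusions modulo ν-null sets) stabilizes. Then ν(Y) ∈ {0,1} for every Y ∈ F. -/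
noncomputable section
open scoped ComplexOrder ENNReal
open MeasureTheory Filter Topology
set_option linter.unusedSectionVars false
set_option maxHeartbeats 1000000
set_option synthInstance.maxHeartbeats 400000

namespace RW

section Stationary

open scoped Pointwise

variable {Γ : Type*} [Group Γ] {X : Type*} [MeasurableSpace X] [MulAction Γ X]

theorem ProbOn.tsum_ofReal_w (μ : ProbOn Γ) : ∑' g, ENNReal.ofReal (μ.w g) = 1 := by
  rw [← ENNReal.ofReal_tsum_of_nonneg μ.nonneg μ.hasSum.summable, μ.hasSum.tsum_eq,
    ENNReal.ofReal_one]

theorem ProbOn.Generating.induction {μ : ProbOn Γ} (hgen : μ.Generating) {P : Γ → Prop} {a : Γ}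
    (ha : P a) (hstep : ∀ h, P h → ∀ g, 0 < μ.w g → P (g⁻¹ * h)) (k : Γ) : P k := by
  have key : ∀ l : List Γ, (∀ x ∈ l, 0 < μ.w x) → ∀ h, P h → P (l.prod⁻¹ * h) := by
    intro l
    induction l with
    | nil => intro _ h hh; simpa using hh
    | cons g l ih =>
      intro hl h hh
      have := ih (fun x hx => hl x (List.mem_cons_of_mem _ hx)) _
        (hstep h hh g (hl g List.mem_cons_self))
      simpa [mul_assoc] using this
  obtain ⟨l, -, hl, hprod⟩ := hgen (a * k⁻¹)
  simpa [hprod] using key l hl a ha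

variable [MeasurableConstSMul Γ X] {μ : ProbOn Γ} {ν : Measure X}

theorem IsStatMeasure.apply (hstat : IsStatMeasure μ ν) {A : Set X} (hA : MeasurableSet A) :
    ν A = ∑' g : Γ, ENNReal.ofReal (μ.w g) * ν (g⁻¹ • A) := by
  conv_lhs => rw [hstat]
  rw [Measure.sum_apply _ hA]
  refine tsum_congr fun g => ?_
  rw [Measure.smul_apply, smul_eq_mul, Measure.map_apply (measurable_const_smul g) hA,
    Set.preimage_smul]

theorem IsStatMeasure.measure_smul_eq_zero (hgen : μ.Generating) (hstat : IsStatMeasure μ ν)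
    {A : Set X} (hA : MeasurableSet A) (h0 : ν A = 0) (k : Γ) : ν (k • A) = 0 := by
  refine hgen.induction (P := fun k => ν (k • A) = 0) (a := 1) (by simpa using h0) ?_ k
  intro h hh g hg
  rw [hstat.apply (hA.const_smul h), ENNReal.tsum_eq_zero] at hh
  have := hh g
  rw [mul_eq_zero, ENNReal.ofReal_eq_zero] at this
  rw [mul_smul]
  exact this.resolve_left (not_le.2 hg)

/-- The maximum principle for the harmonic function `g ↦ ν (g • A)`. -/
theorem IsStatMeasure.measure_smul_eq_of_max [IsFiniteMeasure ν] (hgen : μ.Generating)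
    (hstat : IsStatMeasure μ ν) {A : Set X} (hA : MeasurableSet A) {a : Γ}
    (hmax : ∀ g : Γ, ν (g • A) ≤ ν (a • A)) (k : Γ) : ν (k • A) = ν (a • A) := by
  refine hgen.induction (P := fun k => ν (k • A) = ν (a • A)) (a := a) rfl ?_ k
  intro h hh g hg
  refine le_antisymm (hmax _) ?_
  by_contra! hlt
  have hsum : ∑' g : Γ, ENNReal.ofReal (μ.w g) * ν (a • A) = ν (a • A) := by
    rw [ENNReal.tsum_mul_right, μ.tsum_ofReal_w, one_mul]
  have hstep := hstat.apply (hA.const_smul h)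
  have : ∑' g : Γ, ENNReal.ofReal (μ.w g) * ν (g⁻¹ • h • A)
      < ∑' g : Γ, ENNReal.ofReal (μ.w g) * ν (a • A) := by
    refine ENNReal.tsum_lt_tsum (i := g) ?_ (fun g' => ?_) ?_
    · rw [← hstep]
      exact measure_ne_top _ _
    · rw [smul_smul]
      exact mul_le_mul_right (hmax _) _
    · rw [smul_smul]
      exact ENNReal.mul_lt_mul_right (by simpa using hg) ENNReal.ofReal_ne_top hlt
  rw [← hstep, hsum, hh] at this
  exact lt_irrefl _ this

/-- If the translates of a non-null set `A` are pairwise equal or disjoint modulo null sets, then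
all of them have the same measure, and there are `n` of them, covering mass `1`. -/
theorem IsStatMeasure.exists_partition [Countable Γ] [IsProbabilityMeasure ν]
    (hgen : μ.Generating) (hstat : IsStatMeasure μ ν)
    (herg : ∀ s : Set X, MeasurableSet s → (∀ g : Γ, g • s = s) → ν s = 0 ∨ ν s = 1)
    {A : Set X} (hA : MeasurableSet A) (h0 : ν A ≠ 0)
    (hdich : ∀ g h : Γ, ν (g • A ∩ h • A) = 0 ∨ g • A =ᵐ[ν] h • A) :
    ∃ (n : ℕ) (g : Fin n → Γ), n * ν A = 1 ∧ (∀ g' : Γ, ∃ i, g' • A =ᵐ[ν] g i • A) ∧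
      (∀ i j, i ≠ j → ν (g i • A ∩ g j • A) = 0) ∧ ν (⋃ i, g i • A) = 1 := by
  let S : Setoid Γ :=
    { r := fun g h => g • A =ᵐ[ν] h • A
      iseqv := ⟨fun _ => EventuallyEq.rfl, EventuallyEq.symm, EventuallyEq.trans⟩ }
  let r : Quotient S → Γ := Quotient.out
  have hr (g : Γ) : r ⟦g⟧ • A =ᵐ[ν] g • A := Quotient.exact (Quotient.out_eq (⟦g⟧ : Quotient S))
  have hdisj (i j : Quotient S) (hij : i ≠ j) : ν (r i • A ∩ r j • A) = 0 :=
    (hdich (r i) (r j)).resolve_right fun h => hij <| by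
      simpa only [r, Quotient.out_eq] using (Quotient.sound h : (⟦r i⟧ : Quotient S) = ⟦r j⟧)
  have hfin : {i | ν A ≤ ν (r i • A)}.Finite :=
    Measure.finite_const_le_meas_of_disjoint_iUnion₀ ν (pos_iff_ne_zero.2 h0)
      (fun i => (hA.const_smul _).nullMeasurableSet) hdisj (measure_ne_top _ _)
  have hone : ν (r ⟦1⟧ • A) = ν A := by
    simpa using measure_congr (hr 1)
  obtain ⟨m, hmA, hm⟩ := hfin.exists_maximalFor (fun i => ν (r i • A)) _ ⟨⟦1⟧, hone.ge⟩
  have hmax (g : Γ) : ν (g • A) ≤ ν (r m • A) := by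
    rw [← measure_congr (hr g)]
    rcases le_total (ν A) (ν (r ⟦g⟧ • A)) with h | h
    · exact (le_total _ _).elim id (hm h)
    · exact h.trans hmA
  have hconst (k : Γ) : ν (k • A) = ν A := by
    have h := hstat.measure_smul_eq_of_max hgen hA hmax
    rw [h k, ← h 1, one_smul]
  have : Finite (Quotient S) := by
    rw [← Set.finite_univ_iff]
    exact hfin.subset fun i _ => (hconst (r i)).ge
  have hcover : (⋃ i, r i • A) =ᵐ[ν] ⋃ g : Γ, g • A := by
    refine Filter.EventuallyLE.antisymm (LE.le.eventuallyLE ?_) ?_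
    · exact Set.iUnion_subset fun i => Set.subset_iUnion (fun g : Γ => g • A) (r i)
    · rw [ae_le_set, Set.iUnion_sdiff, measure_iUnion_null_iff]
      exact fun g => measure_mono_null
        (Set.sdiff_subset_sdiff_right (Set.subset_iUnion (fun i => r i • A) ⟦g⟧))
        (ae_le_set.1 (hr g).symm.le)
  have htot : ν (⋃ i, r i • A) = 1 := by
    rw [measure_congr hcover]
    refine (herg _ (MeasurableSet.iUnion fun g => hA.const_smul g) fun g => ?_).resolve_left ?_
    · rw [Set.smul_set_iUnion]
      simp_rw [smul_smul]
      exact (Equiv.mulLeft g).surjective.iUnion_comp fun h => h • A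
    · refine fun h => h0 (measure_mono_null ?_ h)
      simpa using Set.subset_iUnion (fun g : Γ => g • A) 1
  let e := (Finite.equivFin (Quotient S)).symm
  have htot' : ν (⋃ i, r (e i) • A) = 1 := by
    rw [← htot, e.surjective.iUnion_comp fun i => r i • A]
  have hdisj' (i j) (hij : i ≠ j) : ν (r (e i) • A ∩ r (e j) • A) = 0 :=
    hdisj _ _ (e.injective.ne hij)
  refine ⟨_, fun i => r (e i), ?_, fun g => ⟨e.symm ⟦g⟧, ?_⟩, hdisj', htot'⟩
  · rw [← htot', measure_iUnion₀ hdisj' fun i => (hA.const_smul _).nullMeasurableSet]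
    simp [hconst]
  · simp only [e.apply_symm_apply]
    exact (hr g).symm

/-- Every non-null member of a Noetherian family contains a minimal non-null member. -/
theorem exists_minimal_of_noetherian {X : Type*} [MeasurableSpace X] {ν : Measure X}
    {F : Set (Set X)}
    (hFnoeth : ∀ c : ℕ → Set X, (∀ n, c n ∈ F) → (∀ n, ν (c (n + 1) \ c n) = 0) →
      ∃ N, ∀ n, N ≤ n → ν (symmDiff (c n) (c N)) = 0)
    {Y : Set X} (hY : Y ∈ F) (h0 : ν Y ≠ 0) :
    ∃ Z ∈ F, ν Z ≠ 0 ∧ Z ≤ᵐ[ν] Y ∧ ∀ W ∈ F, ν W ≠ 0 → W ≤ᵐ[ν] Z → Z ≤ᵐ[ν] W := by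
  by_contra! H
  let T := {Z : Set X // Z ∈ F ∧ ν Z ≠ 0 ∧ Z ≤ᵐ[ν] Y}
  have hnext (Z : T) : ∃ W : T, W.1 ≤ᵐ[ν] Z.1 ∧ ¬ Z.1 ≤ᵐ[ν] W.1 := by
    obtain ⟨W, hWF, hW0, hWZ, hZW⟩ := H Z.1 Z.2.1 Z.2.2.1 Z.2.2.2
    exact ⟨⟨W, hWF, hW0, hWZ.trans Z.2.2.2⟩, hWZ, hZW⟩
  choose next hle hnot using hnext
  let c : ℕ → T := fun n => next^[n] ⟨Y, hY, h0, EventuallyLE.rfl⟩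
  have hc (n : ℕ) : c (n + 1) = next (c n) := Function.iterate_succ_apply' _ _ _
  obtain ⟨N, hN⟩ := hFnoeth (fun n => (c n).1) (fun n => (c n).2.1) fun n => by
    rw [hc]
    exact ae_le_set.1 (hle _)
  have h := hN (N + 1) N.le_succ
  rw [measure_symmDiff_eq_zero_iff, hc] at h
  exact hnot _ h.symm.le

/-- Translates of a minimal non-null member of an invariant lower semilattice are pairwise equal
or disjoint modulo null sets. -/
theorem IsStatMeasure.smul_inter_null_or_ae_eq (hgen : μ.Generating) (hstat : IsStatMeasure μ ν)
    {F : Set (Set X)}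
    (hFinv : ∀ (g : Γ), ∀ Y ∈ F, ∃ Z ∈ F, g • Y =ᵐ[ν] Z)
    (hFcap : ∀ Y ∈ F, ∀ Z ∈ F, ∃ W ∈ F, (Y ∩ Z : Set X) =ᵐ[ν] W)
    {A : Set X} (hAF : A ∈ F) (hA : MeasurableSet A)
    (hmin : ∀ W ∈ F, ν W ≠ 0 → W ≤ᵐ[ν] A → A ≤ᵐ[ν] W) (g h : Γ) :
    ν (g • A ∩ h • A) = 0 ∨ g • A =ᵐ[ν] h • A := by
  have hle (g : Γ) (hg : ν (A ∩ g • A) ≠ 0) : A ≤ᵐ[ν] g • A := by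
    obtain ⟨Z, hZF, hZ⟩ := hFinv g A hAF
    obtain ⟨W, hWF, hW⟩ := hFcap A hAF Z hZF
    have hWA : (A ∩ g • A : Set X) =ᵐ[ν] W := ((ae_eq_refl A).inter hZ).trans hW
    have hAW : A ≤ᵐ[ν] W := by
      refine hmin W hWF (by rwa [← measure_congr hWA]) ?_
      exact hWA.symm.le.trans Set.inter_subset_left.eventuallyLE
    exact (hAW.trans hWA.symm.le).trans Set.inter_subset_right.eventuallyLE
  have hle' (g h : Γ) (hgh : ν (g • A ∩ h • A) ≠ 0) : g • A ≤ᵐ[ν] h • A := by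
    have h1 : ν (A ∩ (g⁻¹ * h) • A) ≠ 0 := fun h0 => hgh <| by
      have := hstat.measure_smul_eq_zero hgen (hA.inter (hA.const_smul _)) h0 g
      rwa [Set.smul_set_inter, smul_smul, mul_inv_cancel_left] at this
    have h2 := hstat.measure_smul_eq_zero hgen (hA.diff (hA.const_smul _))
      (ae_le_set.1 (hle _ h1)) g
    rwa [Set.smul_set_sdiff, smul_smul, mul_inv_cancel_left, ← ae_le_set] at h2
  refine or_iff_not_imp_left.2 fun hgh => (hle' g h hgh).antisymm (hle' h g ?_)
  rwa [Set.inter_comm]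

end Stationary

end RW

open RW in
/-- 0-1 Law for Noetherian actions. -/
theorem zero_one_law_noetherian
    {Γ : Type*} [Group Γ] [Countable Γ]
    {X : Type*} [TopologicalSpace X] [CompactSpace X] [TopologicalSpace.MetrizableSpace X]
    [MeasurableSpace X] [BorelSpace X] [MulAction Γ X]
    (hcont : ∀ g : Γ, Continuous fun x : X => g • x)
    (μ : ProbOn Γ) (hgen : μ.Generating)
    (ν : Measure X) [IsProbabilityMeasure ν] (hstat : IsStatMeasure μ ν)
    (herg : ∀ s : Set X, MeasurableSet s → (∀ g : Γ, (fun x : X => g • x) '' s = s) →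
      ν s = 0 ∨ ν s = 1)
    (hnofinite : ¬ ∃ (n : ℕ) (Y : Set X), 2 ≤ n ∧ MeasurableSet Y ∧ ν Y = 1 / n ∧
      ∃ g : Fin n → Γ,
        (∀ g' : Γ, ∃ i, ν (symmDiff ((fun x : X => g' • x) '' Y) ((fun x : X => g i • x) '' Y)) = 0) ∧
        (∀ i j, i ≠ j →
          ν (((fun x : X => g i • x) '' Y) ∩ ((fun x : X => g j • x) '' Y)) = 0) ∧
        ν (⋃ i, (fun x : X => g i • x) '' Y) = 1)
    (F : Set (Set X))
    (hFmeas : ∀ Y ∈ F, MeasurableSet Y)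
    (hFinv : ∀ (g : Γ), ∀ Y ∈ F, ∃ Z ∈ F, ν (symmDiff ((fun x : X => g • x) '' Y) Z) = 0)
    (hFcap : ∀ Y ∈ F, ∀ Z ∈ F, ∃ W ∈ F, ν (symmDiff (Y ∩ Z) W) = 0)
    (hFnoeth : ∀ c : ℕ → Set X, (∀ n, c n ∈ F) → (∀ n, ν (c (n + 1) \ c n) = 0) →
      ∃ N, ∀ n, N ≤ n → ν (symmDiff (c n) (c N)) = 0)
    (Y : Set X) (hY : Y ∈ F) :
    ν Y = 0 ∨ ν Y = 1 := by
  have : MeasurableConstSMul Γ X := ⟨fun g => (hcont g).measurable⟩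
  simp only [Set.image_smul, measure_symmDiff_eq_zero_iff] at herg hnofinite hFinv hFcap
  refine or_iff_not_imp_left.2 fun h0 => ?_
  obtain ⟨A, hAF, hA0, hAY, hmin⟩ := exists_minimal_of_noetherian hFnoeth hY h0
  have hA := hFmeas A hAF
  obtain ⟨n, g, hn, hg, hdisj, hunion⟩ := hstat.exists_partition hgen herg hA hA0
    (hstat.smul_inter_null_or_ae_eq hgen hFinv hFcap hAF hA hmin)
  have hn1 : ¬ 2 ≤ n := fun h2 => hnofinite
    ⟨n, A, h2, hA, by rw [one_div]; exact ENNReal.eq_inv_of_mul_eq_one_left (mul_comm (ν A) n ▸ hn),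
      g, hg, hdisj, hunion⟩
  have hn0 : n ≠ 0 := by
    rintro rfl
    simp at hn
  obtain rfl : n = 1 := by omega
  rw [Nat.cast_one, one_mul] at hn
  exact le_antisymm prob_le_one (hn ▸ measure_mono_ae hAY)
end
end
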